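/- arXiv:1607.01311 — 2 statements merged into one kernel-verified Lean document; each statement's English description precedes it below -/
import Mathlib

section
/- For every integer n ≥ 1, the polynomials P_n(x,y,q) satisfy P_{n+1}(x,y,q) = q·y·P_n(x,y,q) + q·x·Σ_{k=0}^{n−1} C(n,k)·P_k(x,y,q)·2^{n−k}·A_{n−k}(x), with initial conditions P_0(x,y,q) = 1 and P_1(x,y,q) = y·q, where C(n,k) is the binomial coefficient and A_m(x) the Eulerian polynomial. -/
open scoped Classical
noncomputable section

/-- The multiset `{1,1,2,2,…,n,n}` as a list. -/
def baseList (n : ℕ) : List ℕ := (List.range n).flatMap (fun i => [i + 1, i + 1])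

/-- A word is Stirling if whenever the same value occurs at positions `i < k`,
every entry strictly between them is greater than that value. -/
def IsStirlingWord (l : List ℕ) : Prop :=
  ∀ i j k : Fin l.length, i < j → j < k → l.get i = l.get k → l.get i < l.get j

/-- The set `Q_n` of Stirling permutations of order `n`:  rearrangements of the
multiset `{1,1,2,2,…,n,n}` in which all entries between the two occurrences of any
value exceed that value. -/
def stirlingPerms (n : ℕ) : Finset (List ℕ) :=
  ((baseList n).permutations.toFinset).filter IsStirlingWord

/-- Number of descents of `σ ∈ Q_n`: indices `i ∈ {1,…,2n}` (here 0-based) with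
`σ_i > σ_{i+1}`, with the convention `σ_{2n+1} = 0`. -/
def desList (l : List ℕ) : ℕ :=
  ((Finset.range l.length).filter (fun i => l.getD (i + 1) 0 < l.getD i 0)).card

/-- The second-order Eulerian polynomial `C_n(x) = ∑_{σ ∈ Q_n} x^{des σ}`. -/
def Cpoly (n : ℕ) : Polynomial ℚ :=
  ∑ σ ∈ stirlingPerms n, Polynomial.X ^ desList σ

/-- A list of cycles is a valid standard cycle form of a Stirling permutation of the
second kind of order `n` if:  the cycles are disjoint and together use each of
`1,1,2,2,…,n,n` exactly once; both copies of any value lie in the same cycle; each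
cycle starts with (one of) its smallest entries; the cycles are listed in increasing
order of their smallest (first) entries; and the word of each cycle reduces to a
Stirling permutation. -/
def IsStirling2 (n : ℕ) (c : List (List ℕ)) : Prop :=
  c.flatten.Perm (baseList n) ∧
  (∀ w ∈ c, w ≠ [] ∧ (∀ v ∈ w, w.count v = 2) ∧ (∀ v ∈ w, w.headI ≤ v) ∧
      IsStirlingWord w) ∧
  c.Chain' (fun w₁ w₂ => w₁.headI < w₂.headI)

/-- The set `Q_n²` of Stirling permutations of the second kind of order `n`,
each recorded as its standard cycle form (a list of cycles). -/
def stirling2 (n : ℕ) : Finset (List (List ℕ)) :=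
  ((((baseList n).permutations.toFinset) ×ˢ (Finset.univ : Finset (Composition (2 * n)))).image
      (fun p => p.1.splitWrtComposition p.2)).filter (IsStirling2 n)

/-- `cyc(σ)`: the number of cycles. -/
def cyc (c : List (List ℕ)) : ℕ := c.length

/-- `cplat(σ)`: the number of cycle plateaus, i.e. entries `c_i` of a cycle
`(c_1,…,c_{2k})` with `c_i = c_{i+1}`, `1 ≤ i < 2k`. -/
def cplat (c : List (List ℕ)) : ℕ :=
  (c.map (fun w => ((Finset.range w.length).filter
    (fun i => i + 1 < w.length ∧ w.getD i 0 = w.getD (i + 1) 0)).card)).sum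

/-- `casc(σ)`: the number of cycle ascents, i.e. entries `c_i` of a cycle
`(c_1,…,c_{2k})` with `c_i < c_{i+1}`, `1 ≤ i < 2k`. -/
def casc (c : List (List ℕ)) : ℕ :=
  (c.map (fun w => ((Finset.range w.length).filter
    (fun i => i + 1 < w.length ∧ w.getD i 0 < w.getD (i + 1) 0)).card)).sum

/-- `cap(σ)`: the number of cycle ascent plateaus, i.e. entries `c_i` of a cycle
`(c_1,…,c_{2k})` with `c_{i-1} < c_i = c_{i+1}`, `2 ≤ i ≤ 2k-1`. -/
def capSt (c : List (List ℕ)) : ℕ :=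
  (c.map (fun w => ((Finset.range w.length).filter
    (fun i => 0 < i ∧ i + 1 < w.length ∧
      w.getD (i - 1) 0 < w.getD i 0 ∧ w.getD i 0 = w.getD (i + 1) 0)).card)).sum

/-- `fix(σ)`: the number of fixed points, i.e. values `k` with `(k,k)` a cycle of `σ`. -/
def fixSt (c : List (List ℕ)) : ℕ :=
  ((Finset.range c.length).filter (fun i => ∃ k : ℕ, c.getD i [] = [k, k])).card

open MvPolynomial in
/-- `P_n(x,y,q) = ∑_{σ ∈ Q_n²} x^{cap(σ)} y^{fix(σ)} q^{cyc(σ)}`, as a polynomial in the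
three variables `x = X 0`, `y = X 1`, `q = X 2`. -/
def Pmv (n : ℕ) : MvPolynomial (Fin 3) ℚ :=
  ∑ σ ∈ stirling2 n, X 0 ^ capSt σ * X 1 ^ fixSt σ * X 2 ^ cyc σ

/-- Number of descents of a permutation of `Fin m`. -/
def desA (m : ℕ) (π : Equiv.Perm (Fin m)) : ℕ :=
  (Finset.univ.filter (fun i : Fin m => ∃ h : i.1 + 1 < m, π ⟨i.1 + 1, h⟩ < π i)).card

open MvPolynomial in
/-- The Eulerian polynomial `A_m(x)`, written in the variable `x = X 0`. -/
def eulerianAMv (m : ℕ) : MvPolynomial (Fin 3) ℚ :=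
  ∑ π : Equiv.Perm (Fin m), X 0 ^ desA m π

namespace StirlingCycles

open MvPolynomial

/-! ### Insertion of two adjacent copies of a new letter -/

/-- All words obtained from `w` by inserting `v v` somewhere after the first letter. -/
def insertWord (v : ℕ) : List ℕ → List (List ℕ)
  | [] => []
  | a :: l => (a :: v :: v :: l) :: (insertWord v l).map (List.cons a)

/-- All lists of cycles obtained from `c` by inserting `v v` into one of the cycles, or by
appending the cycle `(v, v)`. -/
def insertCycle (v : ℕ) : List (List ℕ) → List (List (List ℕ))
  | [] => [[[v, v]]]
  | w :: c => (insertWord v w).map (fun u => u :: c) ++ (insertCycle v c).map (List.cons w)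

/-- The elements of `stirling2 n`, generated by successive insertion. -/
def cycleForms : ℕ → List (List (List ℕ))
  | 0 => [[]]
  | n + 1 => (cycleForms n).flatMap (insertCycle (n + 1))

/-! ### Weights -/

/-- The number of ascent plateaus of a word. -/
def ascPlat : List ℕ → ℕ
  | a :: b :: c :: l => (if a < b ∧ b = c then 1 else 0) + ascPlat (b :: c :: l)
  | _ => 0

/-- The derivation `2x(1-x) ∂/∂x + 2x(1-y) ∂/∂y`. -/
def der : Derivation ℚ (MvPolynomial (Fin 3) ℚ) (MvPolynomial (Fin 3) ℚ) :=
  mkDerivation ℚ ![2 * X 0 * (1 - X 0), 2 * X 0 * (1 - X 1), 0]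

lemma der_X0 : der (X 0) = 2 * X 0 * (1 - X 0) := by simp [der, mkDerivation_X]
lemma der_X1 : der (X 1) = 2 * X 0 * (1 - X 1) := by simp [der, mkDerivation_X]
lemma der_X2 : der (X 2) = 0 := by simp [der, mkDerivation_X]

lemma der_mul (f g : MvPolynomial (Fin 3) ℚ) : der (f * g) = f * der g + g * der f := by
  simp [Derivation.leibniz]

lemma der_X0_pow (c : ℕ) :
    der (X 0 ^ c) = 2 * (c : MvPolynomial (Fin 3) ℚ) * (1 - X 0) * X 0 ^ c := by
  induction c with
  | zero => simp
  | succ c ih => rw [pow_succ, der_mul, ih, der_X0]; push_cast; ring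

/-- The weight of a single cycle. -/
def wordWt (w : List ℕ) : MvPolynomial (Fin 3) ℚ :=
  X 2 * (if ∃ k, w = [k, k] then X 1 else X 0 ^ ascPlat w)

/-- The weight of a list of cycles. -/
def cycleWt (c : List (List ℕ)) : MvPolynomial (Fin 3) ℚ := (c.map wordWt).prod

lemma ascPlat_insert_head {v : ℕ} {b : ℕ} {l : List ℕ} (hb : b < v) (h : ∀ i ∈ l, i < v) :
    ascPlat (b :: v :: v :: l) = 1 + ascPlat l := by
  rcases l with _ | ⟨c, _ | ⟨d, l⟩⟩
  · simp [ascPlat, hb]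
  · have := h c (by simp)
    simp [ascPlat, hb]
  · have h1 := h c (by simp)
    simp [ascPlat, hb, h1.not_gt]

lemma ascPlat_cons_of_not (a b : ℕ) (l : List ℕ) (h : ¬ ∃ t, l = b :: t ∧ a < b) :
    ascPlat (a :: b :: l) = ascPlat (b :: l) := by
  rcases l with _ | ⟨c, l⟩
  · simp [ascPlat]
  · have : ¬ (a < b ∧ b = c) := fun hh => h ⟨l, by rw [hh.2], hh.1⟩
    simp [ascPlat, this]

lemma ascPlat_cons_plateau (a b : ℕ) (l : List ℕ) (h : a < b) :
    ascPlat (a :: b :: b :: l) = 1 + ascPlat (b :: l) := by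
  rw [ascPlat, ascPlat_cons_of_not]
  · simp [h]
  · simp

lemma sum_insertWord_ascPlat {v : ℕ} (w : List ℕ) (h : ∀ i ∈ w, i < v) :
    ((insertWord v w).map (fun u => (X 0 : MvPolynomial (Fin 3) ℚ) ^ ascPlat u)).sum =
      (w.length : MvPolynomial (Fin 3) ℚ) * X 0 * X 0 ^ ascPlat w + der (X 0 ^ ascPlat w) := by
  induction hn : w.length using Nat.strong_induction_on generalizing w with
  | _ n ih =>
  subst hn
  simp only [der_X0_pow] at ih ⊢
  match w, ih, h with
  | [], _, _ => simp [insertWord, ascPlat]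
  | [a], _, h =>
    have : a < v := h a (by simp)
    simp [insertWord, ascPlat, this]
  | a :: b :: l, ih, h =>
    have ha : a < v := h a (by simp)
    have hb : b < v := h b (by simp)
    have hl : ∀ i ∈ l, i < v := fun i hi => h i (by simp [hi])
    have hbl : ∀ i ∈ b :: l, i < v := fun i hi => h i (by simp at hi ⊢; tauto)
    by_cases hab : ∃ t, l = b :: t ∧ a < b
    · obtain ⟨t, rfl, hlt⟩ := hab
      have e1 : ∀ u ∈ insertWord v (b :: t),
          (X 0 : MvPolynomial (Fin 3) ℚ) ^ ascPlat (a :: b :: u) = X 0 * X 0 ^ ascPlat u := by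
        intro u hu
        have : ∃ s, u = b :: s := by
          simp only [insertWord, List.mem_cons, List.mem_map] at hu
          rcases hu with rfl | ⟨s, _, rfl⟩ <;> exact ⟨_, rfl⟩
        obtain ⟨s, rfl⟩ := this
        rw [ascPlat_cons_plateau _ _ _ hlt, pow_add, pow_one]
      have e2 : ascPlat (a :: b :: v :: v :: b :: t) = 1 + ascPlat (b :: t) := by
        rw [ascPlat_cons_of_not, ascPlat_insert_head hb hl]
        simp [hb.ne']
      have e3 := ih (b :: t).length (by simp) (b :: t) hl rfl
      rw [insertWord, insertWord]
      simp only [List.map_cons, List.map_map, List.sum_cons, Function.comp_def]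
      rw [List.map_congr_left e1, List.sum_map_mul_left, e3, ascPlat_insert_head ha hbl, e2,
        ascPlat_cons_plateau _ _ _ hlt, ascPlat_cons_of_not]
      · simp only [pow_add, pow_one, List.length_cons]
        push_cast
        ring
      · simp
    · have e1 : ∀ u ∈ insertWord v (b :: l),
          (X 0 : MvPolynomial (Fin 3) ℚ) ^ ascPlat (a :: u) = X 0 ^ ascPlat u := by
        intro u hu
        simp only [insertWord, List.mem_cons, List.mem_map] at hu
        rcases hu with rfl | ⟨s, hs, rfl⟩
        · rw [ascPlat_cons_of_not]
          simp [hb.ne']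
        · rw [ascPlat_cons_of_not]
          rintro ⟨t, rfl, hlt⟩
          rcases l with _ | ⟨c, l⟩
          · simp [insertWord] at hs
          · simp only [insertWord, List.mem_cons, List.mem_map] at hs
            rcases hs with hs | ⟨s, hs, hs'⟩ <;> simp_all
      have e3 := ih (b :: l).length (by simp) (b :: l) hbl rfl
      rw [insertWord]
      simp only [List.map_cons, List.map_map, List.sum_cons, Function.comp_def]
      rw [List.map_congr_left e1, e3, ascPlat_insert_head ha hbl, ascPlat_cons_of_not _ _ _ hab]
      simp only [pow_add, pow_one, List.length_cons]
      push_cast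
      ring

lemma length_of_mem_insertWord {v : ℕ} {w u : List ℕ} (hu : u ∈ insertWord v w) :
    u.length = w.length + 2 := by
  induction w generalizing u with
  | nil => simp [insertWord] at hu
  | cons a l ih =>
    simp only [insertWord, List.mem_cons, List.mem_map] at hu
    rcases hu with rfl | ⟨s, hs, rfl⟩
    · simp
    · simp [ih hs]

lemma sum_insertWord {v : ℕ} (w : List ℕ) (h : ∀ i ∈ w, i < v) :
    ((insertWord v w).map wordWt).sum =
      (w.length : MvPolynomial (Fin 3) ℚ) * X 0 * wordWt w + der (wordWt w) := by
  by_cases hw : ∃ k, w = [k, k]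
  · obtain ⟨k, rfl⟩ := hw
    have hk : k < v := h k (by simp)
    simp [insertWord, wordWt, ascPlat, hk, hk.ne', der_X1, der_X2]
    ring
  · have e1 : ∀ u ∈ insertWord v w, wordWt u = X 2 * X 0 ^ ascPlat u := by
      intro u hu
      have : ¬ ∃ k, u = [k, k] := by
        rintro ⟨k, rfl⟩
        have := length_of_mem_insertWord hu
        have : w = [] := by simpa using this
        simp [this, insertWord] at hu
      simp [wordWt, this]
    rw [List.map_congr_left e1, List.sum_map_mul_left, sum_insertWord_ascPlat w h, wordWt,
      if_neg hw, der_mul, der_X2]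
    ring

lemma sum_insertCycle {v : ℕ} (c : List (List ℕ)) (h : ∀ w ∈ c, ∀ i ∈ w, i < v) :
    ((insertCycle v c).map cycleWt).sum =
      (X 2 * X 1 + (c.flatten.length : MvPolynomial (Fin 3) ℚ) * X 0) * cycleWt c +
        der (cycleWt c) := by
  induction c with
  | nil => simp [insertCycle, cycleWt, wordWt]
  | cons w c ih =>
    have h1 := sum_insertWord w (h w (by simp))
    have h2 := ih (fun w hw => h w (by simp [hw]))
    have e1 : ∀ u d, cycleWt (u :: d) = cycleWt d * wordWt u := by
      intro u d; simp [cycleWt, mul_comm]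
    have e2 : ∀ u d, cycleWt (u :: d) = wordWt u * cycleWt d := by
      intro u d; simp [cycleWt]
    rw [insertCycle, List.map_append, List.sum_append, List.map_map, List.map_map]
    simp only [Function.comp_def]
    simp only [e1 _ c, e2 w, List.sum_map_mul_left]
    rw [h1, h2, mul_comm (cycleWt c) (wordWt w), der_mul]
    simp
    ring

lemma card_ascPlat (w : List ℕ) :
    ((Finset.range w.length).filter
      (fun i => 0 < i ∧ i + 1 < w.length ∧
        w.getD (i - 1) 0 < w.getD i 0 ∧ w.getD i 0 = w.getD (i + 1) 0)).card = ascPlat w := by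
  induction w with
  | nil => simp [ascPlat]
  | cons a l ih =>
    rcases l with _ | ⟨b, _ | ⟨c, l⟩⟩
    · simp [ascPlat]
    · simp [ascPlat, Finset.filter_eq_empty_iff]
      omega
    · rw [ascPlat, ← ih]
      simp only [Finset.card_filter, List.length_cons]
      rw [Finset.sum_range_succ', Finset.sum_range_succ', Finset.sum_range_succ' _ (l.length + 1)]
      simp only [List.getD_cons_succ, List.getD_cons_zero, Nat.add_sub_cancel]
      simp [add_comm, add_left_comm]

lemma capSt_eq (c : List (List ℕ)) : capSt c = (c.map ascPlat).sum := by
  simp only [capSt, card_ascPlat]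

lemma fixSt_cons (w : List ℕ) (c : List (List ℕ)) :
    fixSt (w :: c) = (if ∃ k, w = [k, k] then 1 else 0) + fixSt c := by
  simp only [fixSt, Finset.card_filter, List.length_cons]
  rw [Finset.sum_range_succ', add_comm]
  simp

lemma cycleWt_eq (c : List (List ℕ)) :
    X 0 ^ capSt c * X 1 ^ fixSt c * X 2 ^ cyc c = cycleWt c := by
  induction c with
  | nil => simp [capSt, fixSt, cyc, cycleWt]
  | cons w c ih =>
    have h1 : cycleWt (w :: c) = wordWt w * cycleWt c := by simp [cycleWt]
    have h2 : capSt (w :: c) = ascPlat w + capSt c := by simp [capSt_eq]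
    have h3 : cyc (w :: c) = cyc c + 1 := rfl
    rw [h1, ← ih, h2, h3, fixSt_cons, wordWt]
    split_ifs with hw
    · obtain ⟨k, rfl⟩ := hw
      simp only [ascPlat, pow_add]
      ring
    · simp only [pow_add]
      ring

/-! ### Membership -/

lemma headI_of_mem_insertWord {v : ℕ} {w u : List ℕ} (hu : u ∈ insertWord v w) :
    u.headI = w.headI := by
  cases w with
  | nil => simp [insertWord] at hu
  | cons a l =>
    simp only [insertWord, List.mem_cons, List.mem_map] at hu
    rcases hu with rfl | ⟨s, hs, rfl⟩ <;> rfl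

lemma mem_insertWord {v : ℕ} {w u : List ℕ} :
    u ∈ insertWord v w ↔ ∃ p s, p ≠ [] ∧ w = p ++ s ∧ u = p ++ v :: v :: s := by
  induction w generalizing u with
  | nil =>
    simp [insertWord]
  | cons a l ih =>
    simp only [insertWord, List.mem_cons, List.mem_map]
    constructor
    · rintro (rfl | ⟨t, ht, rfl⟩)
      · exact ⟨[a], l, by simp, rfl, rfl⟩
      · obtain ⟨p, s, hp, rfl, rfl⟩ := ih.1 ht
        exact ⟨a :: p, s, by simp, rfl, rfl⟩
    · rintro ⟨p, s, hp, h1, rfl⟩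
      rcases p with _ | ⟨b, p⟩
      · exact absurd rfl hp
      · simp only [List.cons_append, List.cons.injEq] at h1
        obtain ⟨rfl, rfl⟩ := h1
        rcases p with _ | ⟨d, p⟩
        · left; rfl
        · right
          exact ⟨d :: p ++ v :: v :: s, ih.2 ⟨d :: p, s, by simp, rfl, rfl⟩, rfl⟩

lemma mem_insertCycle {v : ℕ} {c d : List (List ℕ)} :
    d ∈ insertCycle v c ↔ d = c ++ [[v, v]] ∨
      ∃ c₁ w c₂, ∃ u ∈ insertWord v w, c = c₁ ++ w :: c₂ ∧ d = c₁ ++ u :: c₂ := by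
  induction c generalizing d with
  | nil => simp [insertCycle]
  | cons w c ih =>
    simp only [insertCycle, List.mem_append, List.mem_map]
    constructor
    · rintro (⟨u, hu, rfl⟩ | ⟨e, he, rfl⟩)
      · exact Or.inr ⟨[], w, c, u, hu, rfl, rfl⟩
      · rcases ih.1 he with rfl | ⟨c₁, w', c₂, u, hu, rfl, rfl⟩
        · left; rfl
        · exact Or.inr ⟨w :: c₁, w', c₂, u, hu, rfl, rfl⟩
    · rintro (rfl | ⟨c₁, w', c₂, u, hu, h1, rfl⟩)
      · exact Or.inr ⟨_, ih.2 (Or.inl rfl), rfl⟩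
      · rcases c₁ with _ | ⟨w₁, c₁⟩
        · simp only [List.nil_append, List.cons.injEq] at h1
          obtain ⟨rfl, rfl⟩ := h1
          exact Or.inl ⟨u, hu, rfl⟩
        · simp only [List.cons_append, List.cons.injEq] at h1
          obtain ⟨rfl, rfl⟩ := h1
          exact Or.inr ⟨_, ih.2 (Or.inr ⟨c₁, w', c₂, u, hu, rfl, rfl⟩), rfl⟩

lemma isStirlingWord_iff (l : List ℕ) :
    IsStirlingWord l ↔ ∀ a b, [a, b, a].Sublist l → a < b := by
  constructor
  · intro h a b hs
    obtain ⟨is, h1, h2⟩ := List.sublist_eq_map_getElem hs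
    rcases is with _ | ⟨i, _ | ⟨j, _ | ⟨k, _ | ⟨m, is⟩⟩⟩⟩
    case cons.cons.cons.nil =>
      simp only [List.map_cons, List.map_nil, List.cons.injEq, and_true] at h1
      simp only [List.pairwise_cons, List.mem_cons, List.not_mem_nil, or_false, forall_eq_or_imp,
        forall_eq] at h2
      have := h i j k h2.1.1 h2.2.1 (by simpa using h1.1.symm.trans h1.2.2)
      rw [h1.1, h1.2.1]
      simpa using this
    all_goals simp at h1
  · intro h i j k hij hjk heq
    apply h
    have := List.map_getElem_sublist (l := l) (is := [i, j, k]) (by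
      simp [hij, hjk, hij.trans hjk])
    have e : l[i] = l[k] := heq
    simp only [List.map_cons, List.map_nil] at this
    rw [← e] at this
    exact this

lemma isStirlingWord_insert {v : ℕ} {p s : List ℕ} (hp : v ∉ p) (hs : v ∉ s)
    (h : ∀ i ∈ p ++ s, i < v) (hw : IsStirlingWord (p ++ s)) :
    IsStirlingWord (p ++ v :: v :: s) := by
  rw [isStirlingWord_iff] at hw ⊢
  intro a b hab
  by_cases ha : a = v
  · subst ha
    exfalso
    obtain ⟨l₁, l₂, h1, h2, h3⟩ := List.sublist_append_iff.1 hab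
    rcases l₁ with _ | ⟨x, l₁⟩
    · simp only [List.nil_append] at h1
      subst h1
      have h4 : [b, a].Sublist (a :: s) := by simpa using h3
      have h5 : [a].Sublist s := by
        cases h4 with
        | cons _ h => exact (List.sublist_cons_self _ _).trans h
        | cons_cons _ h => exact h
      exact hs (by simpa using h5)
    · simp only [List.cons_append, List.cons.injEq] at h1
      exact hp (h2.subset (by simp [h1.1]))
  · have ha' : a < v := h a (by
      have := hab.subset (show a ∈ [a, b, a] by simp)
      simpa [ha] using this)
    by_cases hb : b = v
    · omega
    · apply hw
      have hf := hab.filter (fun i => decide (i ≠ v))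
      have e1 : p.filter (fun i => decide (i ≠ v)) = p := by
        rw [List.filter_eq_self]; intro i hi; simp; rintro rfl; exact hp hi
      have e2 : s.filter (fun i => decide (i ≠ v)) = s := by
        rw [List.filter_eq_self]; intro i hi; simp; rintro rfl; exact hs hi
      rw [List.filter_append, List.filter_cons_of_neg (a := v) (by simp),
        List.filter_cons_of_neg (a := v) (by simp), e1, e2] at hf
      simpa [ha, hb] using hf

lemma baseList_succ (n : ℕ) : baseList (n + 1) = baseList n ++ [n + 1, n + 1] := by
  simp [baseList, List.range_succ]

lemma mem_baseList {n i : ℕ} (h : i ∈ baseList n) : i ≤ n := by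
  simp only [baseList, List.mem_flatMap, List.mem_range, List.mem_cons, List.not_mem_nil,
    or_false, or_self] at h
  omega

lemma length_baseList (n : ℕ) : (baseList n).length = 2 * n := by
  induction n with
  | zero => rfl
  | succ n ih => simp [baseList_succ, ih]; ring

/-- The condition imposed on each cycle of a Stirling permutation of the second kind. -/
def IsCycleWord (w : List ℕ) : Prop :=
  w ≠ [] ∧ (∀ v ∈ w, w.count v = 2) ∧ (∀ v ∈ w, w.headI ≤ v) ∧ IsStirlingWord w

lemma isStirling2_iff (n : ℕ) (c : List (List ℕ)) :
    IsStirling2 n c ↔ c.flatten.Perm (baseList n) ∧ (∀ w ∈ c, IsCycleWord w) ∧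
      (c.map List.headI).Pairwise (· < ·) := by
  have : Trans (fun w₁ w₂ : List ℕ => w₁.headI < w₂.headI)
      (fun w₁ w₂ : List ℕ => w₁.headI < w₂.headI) (fun w₁ w₂ : List ℕ => w₁.headI < w₂.headI) :=
    ⟨fun h₁ h₂ => lt_trans h₁ h₂⟩
  rw [List.pairwise_map, ← List.isChain_iff_pairwise]
  rfl

lemma headI_mem {w : List ℕ} (h : w ≠ []) : w.headI ∈ w := by
  cases w with
  | nil => exact absurd rfl h
  | cons a l => simp

lemma IsStirling2.le {n : ℕ} {c : List (List ℕ)} (h : IsStirling2 n c) {w : List ℕ} (hw : w ∈ c)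
    {i : ℕ} (hi : i ∈ w) : i ≤ n :=
  mem_baseList (h.1.subset (List.mem_flatten.2 ⟨w, hw, hi⟩))

lemma IsStirling2.insert {n : ℕ} {c d : List (List ℕ)} (h : IsStirling2 n c)
    (hd : d ∈ insertCycle (n + 1) c) : IsStirling2 (n + 1) d := by
  have hle : ∀ w ∈ c, ∀ i ∈ w, i ≤ n := fun w hw i hi => IsStirling2.le h hw hi
  rw [isStirling2_iff] at h ⊢
  obtain ⟨h1, h2, h3⟩ := h
  rw [baseList_succ]
  rcases mem_insertCycle.1 hd with rfl | ⟨c₁, w, c₂, u, hu, rfl, rfl⟩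
  · refine ⟨by simpa using h1.append_right _, ?_, ?_⟩
    · intro w hw
      rcases List.mem_append.1 hw with hw | hw
      · exact h2 w hw
      · rw [List.mem_singleton] at hw
        subst hw
        refine ⟨by simp, by simp, by simp, ?_⟩
        rintro ⟨i, hi⟩ ⟨j, hj⟩ ⟨k, hk⟩ hij hjk
        simp only [List.length_cons, List.length_nil, Fin.mk_lt_mk] at hi hj hk hij hjk
        omega
    · rw [List.map_append, List.pairwise_append]
      refine ⟨h3, by simp, ?_⟩
      intro a ha b hb
      obtain ⟨w, hw, rfl⟩ := List.mem_map.1 ha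
      have := hle w hw _ (headI_mem (h2 w hw).1)
      simp only [List.map_cons, List.headI_cons, List.map_nil, List.mem_singleton] at hb
      omega
  · have hh := headI_of_mem_insertWord hu
    obtain ⟨p, s, hp, rfl, rfl⟩ := mem_insertWord.1 hu
    have hle' : ∀ i ∈ p ++ s, i ≤ n := fun i hi => hle _ (by simp) i hi
    have hvp : n + 1 ∉ p := fun hv => by have := hle' _ (List.mem_append_left s hv); omega
    have hvs : n + 1 ∉ s := fun hv => by have := hle' _ (List.mem_append_right p hv); omega
    refine ⟨?_, ?_, ?_⟩
    · rw [List.perm_iff_count] at h1 ⊢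
      intro a
      have := h1 a
      simp only [List.flatten_append, List.flatten_cons, List.count_append, List.count_cons,
        List.count_nil] at this ⊢
      omega
    · intro w hw
      have hps := h2 (p ++ s) (by simp)
      obtain ⟨g1, g2, g3, g4⟩ := hps
      simp only [List.mem_append, List.mem_cons] at hw
      rcases hw with hw | rfl | hw
      · exact h2 w (by simp [hw])
      · refine ⟨by simp, ?_, ?_, ?_⟩
        · intro a ha
          by_cases hav : a = n + 1
          · subst hav
            simp [List.count_eq_zero_of_not_mem hvp, List.count_eq_zero_of_not_mem hvs]
          · have := g2 a (by simpa [hav] using ha)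
            simpa [List.count_append, List.count_cons, Ne.symm hav] using this
        · intro a ha
          rw [hh]
          by_cases hav : a = n + 1
          · have := hle' _ (headI_mem g1)
            omega
          · exact g3 a (by simpa [hav] using ha)
        · exact isStirlingWord_insert hvp hvs (fun i hi => Nat.lt_succ_of_le (hle' i hi)) g4
      · exact h2 w (by simp [hw])
    · simpa [hh] using h3

lemma IsCycleWord.exists_split {v : ℕ} {w : List ℕ} (hw : IsCycleWord w) (hv : v ∈ w)
    (hle : ∀ i ∈ w, i ≤ v) : ∃ p s, w = p ++ v :: v :: s ∧ v ∉ p ∧ v ∉ s := by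
  obtain ⟨p, t, rfl, hp⟩ := List.eq_append_cons_of_mem hv
  have hc := hw.2.1 v hv
  rw [List.count_append, List.count_cons_self, List.count_eq_zero_of_not_mem hp] at hc
  have ht : v ∈ t := List.count_pos_iff.1 (by omega)
  obtain ⟨m, s, rfl, hm⟩ := List.eq_append_cons_of_mem ht
  rw [List.count_append, List.count_cons_self, List.count_eq_zero_of_not_mem hm] at hc
  have hs : v ∉ s := List.count_eq_zero.1 (by omega)
  rcases m with _ | ⟨b, m⟩
  · exact ⟨p, s, rfl, hp, hs⟩
  · have h1 := (isStirlingWord_iff _).1 hw.2.2.2 v b (by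
      refine List.Sublist.trans ?_ (List.sublist_append_right _ _)
      refine List.Sublist.cons_cons _ (List.Sublist.cons_cons _ ?_)
      simp)
    have := hle b (by simp)
    omega

lemma IsStirling2.exists_insert {n : ℕ} {d : List (List ℕ)} (h : IsStirling2 (n + 1) d) :
    ∃ c, IsStirling2 n c ∧ d ∈ insertCycle (n + 1) c := by
  have hle : ∀ w ∈ d, ∀ i ∈ w, i ≤ n + 1 := fun w hw i hi => IsStirling2.le h hw hi
  rw [isStirling2_iff] at h
  obtain ⟨h1, h2, h3⟩ := h
  have hv : n + 1 ∈ d.flatten := h1.symm.subset (by simp [baseList_succ])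
  obtain ⟨w, hw, hvw⟩ := List.mem_flatten.1 hv
  obtain ⟨d₁, d₂, rfl⟩ := List.append_of_mem hw
  obtain ⟨p, s, rfl, hp, hs⟩ := (h2 w hw).exists_split hvw (hle w hw)
  obtain ⟨g1, g2, g3, g4⟩ := h2 _ hw
  rw [baseList_succ] at h1
  rcases eq_or_ne p [] with rfl | hpn
  · have hs' : s = [] := by
      rw [List.eq_nil_iff_forall_not_mem]
      intro a ha
      have e1 := g3 a (by simp [ha])
      have e2 := hle _ hw a (by simp [ha])
      have : a = n + 1 := le_antisymm e2 (by simpa using e1)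
      exact hs (this ▸ ha)
    subst hs'
    have hd : d₂ = [] := by
      rw [List.eq_nil_iff_forall_not_mem]
      intro u hu
      have e1 := hle u (by simp [hu]) _ (headI_mem (h2 u (by simp [hu])).1)
      rw [List.map_append, List.map_cons, List.pairwise_append, List.pairwise_cons] at h3
      have e2 := h3.2.1.1 _ (List.mem_map_of_mem hu)
      simp only [List.nil_append, List.headI_cons] at e2
      omega
    subst hd
    refine ⟨d₁, (isStirling2_iff _ _).2 ⟨?_, fun w hw => h2 w (by simp [hw]), ?_⟩,
      mem_insertCycle.2 (Or.inl rfl)⟩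
    · exact (List.perm_append_right_iff _).1 (by simpa using h1)
    · rw [List.map_append, List.pairwise_append] at h3
      exact h3.1
  · have hu : p ++ (n + 1) :: (n + 1) :: s ∈ insertWord (n + 1) (p ++ s) :=
      mem_insertWord.2 ⟨p, s, hpn, rfl, rfl⟩
    have hh := headI_of_mem_insertWord hu
    refine ⟨d₁ ++ (p ++ s) :: d₂, (isStirling2_iff _ _).2 ⟨?_, ?_, ?_⟩,
      mem_insertCycle.2 (Or.inr ⟨d₁, p ++ s, d₂, _, hu, rfl, rfl⟩)⟩
    · rw [List.perm_iff_count] at h1 ⊢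
      intro a
      have := h1 a
      simp only [List.flatten_append, List.flatten_cons, List.count_append, List.count_cons,
        List.count_nil] at this ⊢
      omega
    · intro w hw
      simp only [List.mem_append, List.mem_cons] at hw
      rcases hw with hw | rfl | hw
      · exact h2 w (by simp [hw])
      · refine ⟨by simp [hpn], ?_, ?_, ?_⟩
        · intro a ha
          have hav : n + 1 ≠ a := by
            rintro rfl
            simp [hp, hs] at ha
          have := g2 a (by simp at ha ⊢; tauto)
          simpa [List.count_append, List.count_cons, hav] using this
        · intro a ha
          rw [← hh]
          exact g3 a (by simp at ha ⊢; tauto)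
        · rw [isStirlingWord_iff] at g4 ⊢
          intro a b hab
          refine g4 a b (hab.trans ?_)
          exact List.Sublist.append_left ((List.sublist_cons_self _ _).trans
            (List.sublist_cons_self _ _)) p
      · exact h2 w (by simp [hw])
    · simpa [hh] using h3

lemma mem_cycleForms {n : ℕ} {c : List (List ℕ)} : c ∈ cycleForms n ↔ IsStirling2 n c := by
  induction n generalizing c with
  | zero =>
    rw [cycleForms, List.mem_singleton, isStirling2_iff]
    constructor
    · rintro rfl
      simp [baseList]
    · rintro ⟨h1, h2, -⟩
      rw [List.eq_nil_iff_forall_not_mem]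
      intro w hw
      have h3 : c.flatten = [] := by simpa [baseList] using h1
      exact (h2 w hw).1 (List.flatten_eq_nil_iff.1 h3 w hw)
  | succ n ih =>
    rw [cycleForms, List.mem_flatMap]
    constructor
    · rintro ⟨e, he, hc⟩
      exact IsStirling2.insert (ih.1 he) hc
    · intro h
      obtain ⟨e, he, hc⟩ := IsStirling2.exists_insert h
      exact ⟨e, ih.2 he, hc⟩

lemma mem_stirling2 {n : ℕ} {c : List (List ℕ)} : c ∈ stirling2 n ↔ IsStirling2 n c := by
  rw [stirling2, Finset.mem_filter, and_iff_right_iff_imp]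
  intro h
  have hlen : c.flatten.length = 2 * n := by rw [h.1.length_eq, length_baseList]
  rw [Finset.mem_image]
  refine ⟨(c.flatten, ⟨c.map List.length, ?_, ?_⟩), ?_, ?_⟩
  · intro i hi
    obtain ⟨w, hw, rfl⟩ := List.mem_map.1 hi
    exact List.length_pos_iff.2 (h.2.1 w hw).1
  · rw [← hlen, List.length_flatten]
  · simpa using h.1
  · exact List.splitWrtComposition_flatten c ⟨c.map List.length, by
      intro i hi
      obtain ⟨w, hw, rfl⟩ := List.mem_map.1 hi
      exact List.length_pos_iff.2 (h.2.1 w hw).1, by rw [List.length_flatten]⟩ rfl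

lemma nodup_insertWord {v : ℕ} {w : List ℕ} (hv : v ∉ w) : (insertWord v w).Nodup := by
  induction w with
  | nil => simp [insertWord]
  | cons a l ih =>
    rw [insertWord, List.nodup_cons]
    refine ⟨?_, (ih (by simp at hv; tauto)).map List.cons_injective⟩
    simp only [List.mem_map, List.cons.injEq, true_and, exists_eq_right]
    intro h
    rcases l with _ | ⟨b, l⟩
    · simp [insertWord] at h
    · have := headI_of_mem_insertWord h
      simp only [List.headI_cons] at this
      simp [this] at hv

lemma nodup_insertCycle {v : ℕ} {c : List (List ℕ)} (hv : ∀ w ∈ c, v ∉ w) :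
    (insertCycle v c).Nodup := by
  induction c with
  | nil => simp [insertCycle]
  | cons w c ih =>
    rw [insertCycle, List.nodup_append']
    refine ⟨(nodup_insertWord (hv w (by simp))).map (fun a b h => by simpa using h),
      (ih fun w hw => hv w (by simp [hw])).map List.cons_injective, ?_⟩
    intro e h1 h2
    obtain ⟨u, hu, rfl⟩ := List.mem_map.1 h1
    obtain ⟨f, -, hf⟩ := List.mem_map.1 h2
    obtain ⟨p, s, -, -, rfl⟩ := mem_insertWord.1 hu
    have : w = p ++ v :: v :: s := by simpa using congrArg List.headI hf
    exact hv w (by simp) (by simp [this])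

/-- Deleting all copies of a letter, and the cycles that become empty. -/
def deleteLetter (v : ℕ) (c : List (List ℕ)) : List (List ℕ) :=
  (c.map (fun w => w.filter (fun i => decide (i ≠ v)))).filter (fun w => decide (w ≠ []))

lemma deleteLetter_eq_self {v : ℕ} {c : List (List ℕ)} (hv : ∀ w ∈ c, v ∉ w)
    (hc : ∀ w ∈ c, w ≠ []) : deleteLetter v c = c := by
  have : c.map (fun w => w.filter (fun i => decide (i ≠ v))) = c := by
    conv_rhs => rw [← List.map_id c]
    refine List.map_congr_left fun w hw => List.filter_eq_self.2 fun i hi => ?_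
    simpa using fun h : i = v => hv w hw (h ▸ hi)
  rw [deleteLetter, this, List.filter_eq_self]
  simpa using hc

lemma deleteLetter_insertCycle {v : ℕ} {c d : List (List ℕ)} (hd : d ∈ insertCycle v c) :
    deleteLetter v d = deleteLetter v c := by
  rcases mem_insertCycle.1 hd with rfl | ⟨c₁, w, c₂, u, hu, rfl, rfl⟩
  · simp [deleteLetter]
  · obtain ⟨p, s, -, rfl, rfl⟩ := mem_insertWord.1 hu
    simp [deleteLetter]

lemma nodup_cycleForms (n : ℕ) : (cycleForms n).Nodup := by
  induction n with
  | zero => simp [cycleForms]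
  | succ n ih =>
    have hv : ∀ c ∈ cycleForms n, ∀ w ∈ c, n + 1 ∉ w := fun c hc w hw h => by
      have := IsStirling2.le (mem_cycleForms.1 hc) hw h
      omega
    have hne : ∀ c ∈ cycleForms n, ∀ w ∈ c, w ≠ [] := fun c hc w hw =>
      ((mem_cycleForms.1 hc).2.1 w hw).1
    rw [cycleForms, List.nodup_flatMap]
    refine ⟨fun c hc => nodup_insertCycle (hv c hc), ih.imp_of_mem fun {a b} ha hb hab => ?_⟩
    intro d hda hdb
    apply hab
    rw [← deleteLetter_eq_self (hv a ha) (hne a ha), ← deleteLetter_eq_self (hv b hb) (hne b hb),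
      ← deleteLetter_insertCycle hda, deleteLetter_insertCycle hdb]

lemma Pmv_eq (n : ℕ) : Pmv n = ((cycleForms n).map cycleWt).sum := by
  have : stirling2 n = (cycleForms n).toFinset := by
    ext c
    rw [mem_stirling2, List.mem_toFinset, mem_cycleForms]
  rw [Pmv, this, List.sum_toFinset _ (nodup_cycleForms n)]
  simp only [cycleWt_eq]

lemma sum_map_flatMap {α β M : Type*} [AddCommMonoid M] (l : List α) (f : α → List β)
    (g : β → M) : ((l.flatMap f).map g).sum = (l.map fun a => ((f a).map g).sum).sum := by
  induction l with
  | nil => rfl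
  | cons a l ih => simp [ih]

lemma Pmv_zero : Pmv 0 = 1 := by simp [Pmv_eq, cycleForms, cycleWt]

lemma Pmv_succ (n : ℕ) :
    Pmv (n + 1) = (X 2 * X 1 + 2 * (n : MvPolynomial (Fin 3) ℚ) * X 0) * Pmv n + der (Pmv n) := by
  rw [Pmv_eq, Pmv_eq, cycleForms, sum_map_flatMap, map_list_sum,
    ← List.sum_map_mul_left, List.map_map, ← List.sum_map_add]
  refine congrArg List.sum (List.map_congr_left fun c hc => ?_)
  have h := mem_cycleForms.1 hc
  rw [sum_insertCycle c fun w hw i hi => Nat.lt_succ_of_le (IsStirling2.le h hw hi),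
    h.1.length_eq, length_baseList]
  push_cast
  rfl

/-! ### The Eulerian polynomials -/

/-- The number of descents of a word. -/
def descents : List ℕ → ℕ
  | a :: b :: l => (if b < a then 1 else 0) + descents (b :: l)
  | _ => 0

lemma card_descents (w : List ℕ) :
    ((Finset.range w.length).filter
      (fun i => i + 1 < w.length ∧ w.getD (i + 1) 0 < w.getD i 0)).card = descents w := by
  induction w with
  | nil => simp [descents]
  | cons a l ih =>
    rcases l with _ | ⟨b, l⟩
    · simp [descents]
    · rw [descents, ← ih]
      simp only [Finset.card_filter, List.length_cons]
      rw [Finset.sum_range_succ']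
      simp only [List.getD_cons_succ, List.getD_cons_zero]
      simp [add_comm]

/-- The one-line notation of a permutation. -/
def oneLine {m : ℕ} (π : Equiv.Perm (Fin m)) : List ℕ := List.ofFn fun i => (π i : ℕ)

lemma desA_eq {m : ℕ} (π : Equiv.Perm (Fin m)) : desA m π = descents (oneLine π) := by
  rw [← card_descents, desA, Finset.card_filter, Finset.card_filter, oneLine, List.length_ofFn,
    ← Fin.sum_univ_eq_sum_range]
  refine Finset.sum_congr rfl fun i _ => if_congr ?_ rfl rfl
  simp only [List.getD_eq_getElem?_getD, List.getElem?_ofFn]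
  by_cases h : (i : ℕ) + 1 < m <;> simp [h]

lemma oneLine_injective (m : ℕ) : Function.Injective (oneLine (m := m)) := by
  intro π ρ h
  ext i
  exact congrFun (List.ofFn_injective h) i

lemma oneLine_perm {m : ℕ} (π : Equiv.Perm (Fin m)) :
    (oneLine π).Perm (List.range m).reverse := by
  refine List.Perm.trans ?_ (List.reverse_perm _).symm
  have h : oneLine π = (List.ofFn π).map (fun i : Fin m => (i : ℕ)) := by
    simp [oneLine, List.map_ofFn, Function.comp_def]
  rw [h, ← List.map_coe_finRange_eq_range]
  refine List.Perm.map _ ((List.perm_ext_iff_of_nodup ?_ (List.nodup_finRange m)).2 ?_)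
  · exact List.nodup_ofFn.2 π.injective
  · intro i
    simp [List.mem_ofFn, π.surjective i]

lemma nodup_reverse_range_permutations' (m : ℕ) : (List.range m).reverse.permutations'.Nodup :=
  (List.permutations_perm_permutations' _).nodup_iff.1
    (List.nodup_permutations _ (List.nodup_reverse.2 List.nodup_range))

lemma eulerianAMv_eq (m : ℕ) :
    eulerianAMv m =
      ((List.range m).reverse.permutations'.map fun w => X 0 ^ descents w).sum := by
  rw [← List.sum_toFinset _ (nodup_reverse_range_permutations' m)]
  have : (List.range m).reverse.permutations'.toFinset = Finset.univ.image (oneLine (m := m)) := by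
    symm
    apply Finset.eq_of_subset_of_card_le
    · intro w hw
      obtain ⟨π, -, rfl⟩ := Finset.mem_image.1 hw
      rw [List.mem_toFinset, List.mem_permutations']
      exact oneLine_perm π
    · rw [Finset.card_image_of_injective _ (oneLine_injective m),
        List.toFinset_card_of_nodup (nodup_reverse_range_permutations' m),
        ← (List.permutations_perm_permutations' _).length_eq, List.length_permutations,
        Finset.card_univ, Fintype.card_perm, List.length_reverse, List.length_range,
        Fintype.card_fin]
  rw [this, Finset.sum_image fun _ _ _ _ h => oneLine_injective m h, eulerianAMv]
  simp only [desA_eq]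

lemma sum_insert_after_head {t a : ℕ} (l : List ℕ) (ha : a < t) (h : ∀ i ∈ l, i < t) :
    ((List.permutations'Aux t l).map
        fun u => (X 0 : MvPolynomial (Fin 3) ℚ) ^ descents (a :: u)).sum =
      (1 + (descents (a :: l) : MvPolynomial (Fin 3) ℚ)) * X 0 ^ descents (a :: l) +
        ((l.length : MvPolynomial (Fin 3) ℚ) - (descents (a :: l) : MvPolynomial (Fin 3) ℚ)) *
          X 0 ^ (descents (a :: l) + 1) := by
  induction l generalizing a with
  | nil => simp [descents, ha.not_gt]
  | cons b l ih =>
    have hb : b < t := h b (by simp)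
    have e := ih hb fun i hi => h i (by simp [hi])
    have e1 : descents (a :: t :: b :: l) = 1 + descents (b :: l) := by
      simp [descents, hb, ha.not_gt]
    have e2 : ∀ u, (X 0 : MvPolynomial (Fin 3) ℚ) ^ descents (a :: b :: u) =
        X 0 ^ (if b < a then 1 else 0) * X 0 ^ descents (b :: u) := fun u => by
      rw [descents, pow_add]
    simp only [List.permutations'Aux, List.map_cons, List.map_map, List.sum_cons,
      Function.comp_def]
    simp only [e2, List.sum_map_mul_left]
    rw [e, e1, descents]
    split_ifs <;> simp only [List.length_cons] <;> push_cast <;> ring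

lemma sum_permutations'Aux {t : ℕ} (l : List ℕ) (h : ∀ i ∈ l, i < t) :
    ((List.permutations'Aux t l).map
        fun u => (X 0 : MvPolynomial (Fin 3) ℚ) ^ descents u).sum =
      (1 + (descents l : MvPolynomial (Fin 3) ℚ)) * X 0 ^ descents l +
        ((l.length : MvPolynomial (Fin 3) ℚ) - (descents l : MvPolynomial (Fin 3) ℚ)) *
          X 0 ^ (descents l + 1) := by
  rcases l with _ | ⟨a, l⟩
  · simp [descents]
  · have ha : a < t := h a (by simp)
    have e := sum_insert_after_head l ha fun i hi => h i (by simp [hi])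
    have e1 : descents (t :: a :: l) = 1 + descents (a :: l) := by
      simp [descents, ha]
    simp only [List.permutations'Aux, List.map_cons, List.map_map, List.sum_cons,
      Function.comp_def]
    rw [e, e1]
    simp only [List.length_cons]
    push_cast
    ring

lemma eulerianAMv_succ (m : ℕ) :
    2 * eulerianAMv (m + 1) =
      2 * (1 + (m : MvPolynomial (Fin 3) ℚ) * X 0) * eulerianAMv m + der (eulerianAMv m) := by
  rw [eulerianAMv_eq, eulerianAMv_eq, List.range_succ, List.reverse_append]
  change 2 * (((List.range m).reverse.permutations'.flatMap _).map _).sum = _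
  rw [sum_map_flatMap, map_list_sum, ← List.sum_map_mul_left, ← List.sum_map_mul_left,
    List.map_map, ← List.sum_map_add]
  refine congrArg List.sum (List.map_congr_left fun w hw => ?_)
  have h := List.mem_permutations'.1 hw
  rw [sum_permutations'Aux w fun i hi => by simpa using h.subset hi, h.length_eq,
    List.length_reverse, List.length_range, Function.comp_apply, der_X0_pow]
  ring

lemma eulerianAMv_zero : eulerianAMv 0 = 1 := by
  simp [eulerianAMv_eq, descents]

/-- The polynomial `2^m x A_m(x)`, which enumerates the cycles with `m + 1` distinct entries. -/
def cycleEnum (m : ℕ) : MvPolynomial (Fin 3) ℚ := X 0 * (2 ^ m * eulerianAMv m)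

lemma cycleEnum_one : cycleEnum 1 = 2 * X 0 := by
  have := eulerianAMv_succ 0
  simp only [eulerianAMv_zero] at this
  have h : 2 * eulerianAMv 1 = 2 := by simpa using this
  rw [cycleEnum, pow_one, h, mul_comm]

lemma cycleEnum_succ (m : ℕ) :
    cycleEnum (m + 1) =
      2 * ((m : MvPolynomial (Fin 3) ℚ) + 1) * X 0 * cycleEnum m + der (cycleEnum m) := by
  have h2 : der (2 ^ m) = 0 := by
    have := der.map_natCast (2 ^ m)
    simpa using this
  have h : cycleEnum (m + 1) = X 0 * (2 ^ m * (2 * eulerianAMv (m + 1))) := by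
    rw [cycleEnum, pow_succ]; ring
  rw [h, eulerianAMv_succ, cycleEnum, der_mul, der_mul, h2, der_X0]
  ring

/-! ### The recurrence -/

lemma Pmv_recurrence (n : ℕ) :
    Pmv (n + 1) = X 2 * X 1 * Pmv n + X 2 * ∑ k ∈ Finset.range n,
      (n.choose k : MvPolynomial (Fin 3) ℚ) * (Pmv k * cycleEnum (n - k)) := by
  induction n with
  | zero => simp [Pmv_succ, Pmv_zero]
  | succ n ih =>
    have key : ∀ k ∈ Finset.range n,
        der ((n.choose k : MvPolynomial (Fin 3) ℚ) * (Pmv k * cycleEnum (n - k))) =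
          (n.choose k : MvPolynomial (Fin 3) ℚ) *
            (Pmv (k + 1) * cycleEnum (n - k) + Pmv k * cycleEnum (n + 1 - k)) -
          (X 2 * X 1 + 2 * ((n : MvPolynomial (Fin 3) ℚ) + 1) * X 0) *
            ((n.choose k : MvPolynomial (Fin 3) ℚ) * (Pmv k * cycleEnum (n - k))) := by
      intro k hk
      have hk := Finset.mem_range.1 hk
      obtain ⟨j, rfl⟩ := Nat.exists_eq_add_of_lt hk
      have e1 : k + j + 1 - k = j + 1 := by omega
      have e2 : k + j + 1 + 1 - k = j + 1 + 1 := by omega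
      rw [e1, e2, der_mul, der_mul, Pmv_succ k, cycleEnum_succ (j + 1), der.map_natCast]
      push_cast
      ring
    have pascal : ∑ k ∈ Finset.range (n + 1),
        ((n + 1).choose k : MvPolynomial (Fin 3) ℚ) * (Pmv k * cycleEnum (n + 1 - k)) =
        ∑ k ∈ Finset.range n, (n.choose k : MvPolynomial (Fin 3) ℚ) *
            (Pmv (k + 1) * cycleEnum (n - k) + Pmv k * cycleEnum (n + 1 - k)) +
          Pmv n * cycleEnum 1 := by
      rw [Finset.sum_range_succ']
      have e : ∀ k, (((n + 1).choose (k + 1) : ℕ) : MvPolynomial (Fin 3) ℚ) *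
          (Pmv (k + 1) * cycleEnum (n + 1 - (k + 1))) =
          (n.choose k : MvPolynomial (Fin 3) ℚ) * (Pmv (k + 1) * cycleEnum (n - k)) +
          (n.choose (k + 1) : MvPolynomial (Fin 3) ℚ) *
            (Pmv (k + 1) * cycleEnum (n + 1 - (k + 1))) := fun k => by
        rw [Nat.choose_succ_succ, Nat.add_sub_add_right]
        push_cast
        ring
      simp only [e, Finset.sum_add_distrib, mul_add]
      have e3 := Finset.sum_range_succ' (fun k => (n.choose k : MvPolynomial (Fin 3) ℚ) *
        (Pmv k * cycleEnum (n + 1 - k))) n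
      rw [Finset.sum_range_succ] at e3
      have e4 : n + 1 - n = 1 := by omega
      simp only [Nat.choose_self, Nat.choose_zero_right, e4] at e3 ⊢
      linear_combination -e3
    have hn := Pmv_succ n
    rw [Pmv_succ (n + 1), pascal, cycleEnum_one]
    conv_lhs => rw [ih]
    rw [map_add, der_mul, der_mul (X 2) (∑ k ∈ _, _), der_mul, der_X2, der_X1, map_sum,
      Finset.sum_congr rfl key, Finset.sum_sub_distrib, ← Finset.mul_sum]
    push_cast
    linear_combination (-X 2 * X 1) * hn

end StirlingCycles

open MvPolynomial in
/-- `P_0 = 1`, `P_1 = yq`, and for every `n ≥ 1`: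
`P_{n+1}(x,y,q) = qy P_n(x,y,q) + qx ∑_{k=0}^{n-1} C(n,k) P_k(x,y,q) 2^{n-k} A_{n-k}(x)`. -/
theorem stmt10 :
    Pmv 0 = 1 ∧ Pmv 1 = X 1 * X 2 ∧
    ∀ n : ℕ, 1 ≤ n →
      Pmv (n + 1) =
        X 2 * X 1 * Pmv n +
          X 2 * X 0 * ∑ k ∈ Finset.range n,
            (n.choose k : MvPolynomial (Fin 3) ℚ) * Pmv k *
              ((2 : MvPolynomial (Fin 3) ℚ) ^ (n - k) * eulerianAMv (n - k)) := by
  refine ⟨StirlingCycles.Pmv_zero, ?_, fun n _ => ?_⟩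
  · simp [StirlingCycles.Pmv_recurrence, StirlingCycles.Pmv_zero, mul_comm]
  · have h : ∀ k ∈ Finset.range n,
        (n.choose k : MvPolynomial (Fin 3) ℚ) * (Pmv k * StirlingCycles.cycleEnum (n - k)) =
          X 0 * ((n.choose k : MvPolynomial (Fin 3) ℚ) * Pmv k *
            ((2 : MvPolynomial (Fin 3) ℚ) ^ (n - k) * eulerianAMv (n - k))) := fun k _ => by
      rw [StirlingCycles.cycleEnum]
      ring
    rw [StirlingCycles.Pmv_recurrence, Finset.sum_congr rfl h, ← Finset.mul_sum, ← mul_assoc (X 2)]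
end
end

section
/- For every integer n ≥ 0, P_n(x,y,q) = Σ_{i=0}^{n} C(n,i) · (yq − q)^i · Q_{n−i}(x,q) as an identity of polynomials, where C(n,i) is the binomial coefficient. -/
open scoped Classical
noncomputable section

open MvPolynomial in
/-- `Q_m(x,q) = ∑_{σ ∈ Q_m²} x^{cap(σ)} q^{cyc(σ)}`, written in the variables
`x = X 0`, `q = X 2`. -/
def Qmv (m : ℕ) : MvPolynomial (Fin 3) ℚ :=
  ∑ σ ∈ stirling2 m, X 0 ^ capSt σ * X 2 ^ cyc σ

/-- A word that may occur as a cycle of a Stirling permutation of the second kind. -/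
def IsCycleWord (w : List ℕ) : Prop :=
  w ≠ [] ∧ (∀ v ∈ w, w.count v = 2) ∧ (∀ v ∈ w, w.headI ≤ v) ∧ IsStirlingWord w

/-- The cycle words with support contained in `S`. -/
def cycleWords (S : Finset ℕ) : Finset (List ℕ) :=
  (S.powerset.biUnion fun A => (A.toList.flatMap fun a => [a, a]).permutations.toFinset).filter
    IsCycleWord

/-- The unordered Stirling permutations of the second kind with value set `S`: sets of cycle words
whose supports partition `S`. -/
def cycleSets (S : Finset ℕ) : Finset (Finset (List ℕ)) :=
  (cycleWords S).powerset.filter fun C =>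
    (C : Set (List ℕ)).PairwiseDisjoint List.toFinset ∧ C.biUnion List.toFinset = S

/-- The number of ascent plateaus of a single cycle word. -/
def wordCap (w : List ℕ) : ℕ :=
  ((Finset.range w.length).filter
    (fun i => 0 < i ∧ i + 1 < w.length ∧
      w.getD (i - 1) 0 < w.getD i 0 ∧ w.getD i 0 = w.getD (i + 1) 0)).card

lemma count_flatMap_pair (l : List ℕ) (v : ℕ) :
    (l.flatMap fun a => [a, a]).count v = 2 * l.count v := by
  induction l with
  | nil => simp
  | cons a l ih =>
    rw [List.flatMap_cons, List.count_append, ih]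
    simp only [List.count_cons, List.count_nil]
    ring

lemma mem_cycleWords {S : Finset ℕ} {w : List ℕ} :
    w ∈ cycleWords S ↔ IsCycleWord w ∧ w.toFinset ⊆ S := by
  simp only [cycleWords, Finset.mem_filter, Finset.mem_biUnion, Finset.mem_powerset,
    List.mem_toFinset, List.mem_permutations]
  constructor
  · rintro ⟨⟨A, hA, hp⟩, hw⟩
    refine ⟨hw, fun v hv => hA ?_⟩
    simpa using hp.subset (List.mem_toFinset.mp hv)
  · rintro ⟨hw, hS⟩
    refine ⟨⟨w.toFinset, hS, ?_⟩, hw⟩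
    rw [List.perm_iff_count]
    intro v
    rw [count_flatMap_pair]
    by_cases hv : v ∈ w
    · rw [hw.2.1 v hv, List.count_eq_one_of_mem (Finset.nodup_toList _) (by simpa using hv)]
    · rw [List.count_eq_zero_of_not_mem hv, List.count_eq_zero_of_not_mem (by simpa using hv)]

lemma mem_cycleSets {S : Finset ℕ} {C : Finset (List ℕ)} :
    C ∈ cycleSets S ↔ (∀ w ∈ C, IsCycleWord w) ∧
      (C : Set (List ℕ)).PairwiseDisjoint List.toFinset ∧ C.biUnion List.toFinset = S := by
  simp only [cycleSets, Finset.mem_filter, Finset.mem_powerset]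
  constructor
  · rintro ⟨h, h2⟩
    exact ⟨fun w hw => (mem_cycleWords.mp (h hw)).1, h2⟩
  · rintro ⟨h, h2, h3⟩
    exact ⟨fun w hw => mem_cycleWords.mpr
      ⟨h w hw, h3 ▸ Finset.subset_biUnion_of_mem List.toFinset hw⟩, h2, h3⟩

lemma count_baseList (n v : ℕ) :
    (baseList n).count v = if v ∈ Finset.Icc 1 n then 2 else 0 := by
  induction n with
  | zero => simp [baseList]
  | succ n ih =>
    have h : baseList (n + 1) = baseList n ++ [n + 1, n + 1] := by
      simp [baseList, List.range_succ]
    rw [h, List.count_append, ih]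
    simp only [List.count_cons, List.count_nil, Finset.mem_Icc, beq_iff_eq]
    split_ifs <;> omega

lemma length_baseList (n : ℕ) : (baseList n).length = 2 * n := by
  simp [baseList, mul_comm]

lemma mem_stirling2 {n : ℕ} {c : List (List ℕ)} : c ∈ stirling2 n ↔ IsStirling2 n c := by
  simp only [stirling2, Finset.mem_filter, and_iff_right_iff_imp, Finset.mem_image,
    Finset.mem_product, Finset.mem_univ, and_true, List.mem_toFinset, List.mem_permutations,
    Prod.exists]
  intro h
  have hl : c.flatten.length = 2 * n := h.1.length_eq.trans (length_baseList n)
  have hb : ∀ i ∈ c.map List.length, 0 < i := by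
    intro i hi
    obtain ⟨w, hw, rfl⟩ := List.mem_map.mp hi
    exact List.length_pos_iff.mpr (h.2.1 w hw).1
  have hs : (c.map List.length).sum = 2 * n := by rw [← List.length_flatten, hl]
  refine ⟨c.flatten, ⟨c.map List.length, fun hi => hb _ hi, hs⟩, h.1, ?_⟩
  rw [List.eq_iff_flatten_eq]
  constructor
  · exact List.flatten_splitWrtCompositionAux (hs.trans hl.symm)
  · exact List.map_length_splitWrtCompositionAux (hs.trans hl.symm).le

/-- The relation by which the cycles of a standard cycle form are ordered. -/
abbrev HeadLT (w₁ w₂ : List ℕ) : Prop := w₁.headI < w₂.headI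

instance : Trans HeadLT HeadLT HeadLT := ⟨fun h₁ h₂ => lt_trans h₁ h₂⟩

lemma pairwise_headLT {n : ℕ} {c : List (List ℕ)} (h : IsStirling2 n c) : c.Pairwise HeadLT :=
  List.isChain_iff_pairwise.mp h.2.2

lemma nodup_of_pairwise_headLT {c : List (List ℕ)} (h : c.Pairwise HeadLT) : c.Nodup :=
  List.Pairwise.imp (fun hab hne => hab.ne (congrArg List.headI hne)) h

lemma count_flatten_of_nodup {c : List (List ℕ)} (h : c.Nodup) (v : ℕ) :
    c.flatten.count v = ∑ w ∈ c.toFinset, w.count v := by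
  rw [List.count_flatten, List.sum_toFinset _ h]

lemma toFinset_mem_cycleSets {n : ℕ} {c : List (List ℕ)} (h : IsStirling2 n c) :
    c.toFinset ∈ cycleSets (Finset.Icc 1 n) := by
  have hw : ∀ w ∈ c, IsCycleWord w := h.2.1
  rw [mem_cycleSets]
  refine ⟨fun w hc => hw w (List.mem_toFinset.mp hc), ?_, ?_⟩
  · intro w hwc w' hwc' hne
    simp only [Finset.mem_coe] at hwc hwc'
    rw [Function.onFun, Finset.disjoint_left]
    intro v hv hv'
    have h1 := count_flatten_of_nodup (nodup_of_pairwise_headLT (pairwise_headLT h)) v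
    have h2 := Finset.add_le_sum (f := fun w : List ℕ => w.count v) (fun _ _ => Nat.zero_le _)
      hwc hwc' hne
    rw [h.1.count_eq, count_baseList] at h1
    have h3 := (hw w (List.mem_toFinset.mp hwc)).2.1 v (List.mem_toFinset.mp hv)
    have h4 := (hw w' (List.mem_toFinset.mp hwc')).2.1 v (List.mem_toFinset.mp hv')
    split_ifs at h1 <;> omega
  · ext v
    have : v ∈ c.flatten ↔ v ∈ Finset.Icc 1 n := by
      rw [h.1.mem_iff, ← List.count_pos_iff, count_baseList]
      split_ifs with hv <;> simp [hv]
    rw [← this]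
    simp

lemma exists_stirling2_toFinset_eq {n : ℕ} {C : Finset (List ℕ)}
    (h : C ∈ cycleSets (Finset.Icc 1 n)) : ∃ c, IsStirling2 n c ∧ c.toFinset = C := by
  obtain ⟨hw, hd, hu⟩ := mem_cycleSets.mp h
  let r : List ℕ → List ℕ → Prop := fun w₁ w₂ => w₁.headI ≤ w₂.headI
  have : Std.Total r := ⟨fun a b => le_total a.headI b.headI⟩
  have : IsTrans (List ℕ) r := ⟨fun _ _ _ h₁ h₂ => le_trans h₁ h₂⟩
  let c := C.toList.insertionSort r
  have hperm : c.Perm C.toList := List.perm_insertionSort r _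
  have hmem : ∀ w, w ∈ c ↔ w ∈ C := fun w => by rw [hperm.mem_iff, Finset.mem_toList]
  have hnd : c.Nodup := hperm.nodup_iff.mpr C.nodup_toList
  have hC : c.toFinset = C := by ext w; simp [hmem]
  have hhead : ∀ w ∈ C, w.headI ∈ w := by
    intro w hwC
    cases w with
    | nil => exact absurd rfl (hw _ hwC).1
    | cons a l => simp
  refine ⟨c, ⟨?_, fun w hwc => hw w ((hmem w).mp hwc), ?_⟩, hC⟩
  · rw [List.perm_iff_count]
    intro v
    rw [count_flatten_of_nodup hnd, count_baseList, hC, ← hu]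
    split_ifs with hv
    · obtain ⟨w, hwC, hvw⟩ := Finset.mem_biUnion.mp hv
      rw [List.mem_toFinset] at hvw
      rw [Finset.sum_eq_single_of_mem w hwC, (hw w hwC).2.1 v hvw]
      intro w' hwC' hne
      refine List.count_eq_zero_of_not_mem fun hv' => ?_
      exact Finset.disjoint_left.mp (hd hwC' hwC hne) (List.mem_toFinset.mpr hv')
        (List.mem_toFinset.mpr hvw)
    · refine Finset.sum_eq_zero fun w hwC => List.count_eq_zero_of_not_mem fun hv' => hv ?_
      exact Finset.mem_biUnion.mpr ⟨w, hwC, List.mem_toFinset.mpr hv'⟩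
  · refine List.Pairwise.isChain ?_
    have hs : c.Pairwise r := List.pairwise_insertionSort r _
    refine (hs.and hnd).imp_of_mem ?_
    rintro a b ha hb ⟨hab, hne⟩
    refine lt_of_le_of_ne hab fun he => ?_
    have ha' := (hmem a).mp ha
    have hb' := (hmem b).mp hb
    exact Finset.disjoint_left.mp (hd ha' hb' hne) (List.mem_toFinset.mpr (hhead a ha'))
      (List.mem_toFinset.mpr (he ▸ hhead b hb'))

lemma sum_stirling2 {M : Type*} [CommSemiring M] (n : ℕ) (f : List ℕ → M) :
    ∑ c ∈ stirling2 n, (c.map f).prod =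
      ∑ C ∈ cycleSets (Finset.Icc 1 n), ∏ w ∈ C, f w := by
  refine Finset.sum_bij (fun c _ => c.toFinset)
    (fun c hc => toFinset_mem_cycleSets (mem_stirling2.mp hc)) ?_ ?_ ?_
  · intro c hc c' hc' he
    have h := pairwise_headLT (mem_stirling2.mp hc)
    have h' := pairwise_headLT (mem_stirling2.mp hc')
    exact List.Perm.eq_of_pairwise (fun a b _ _ hab hba => absurd hab hba.not_gt) h h'
      (List.perm_of_nodup_nodup_toFinset_eq (nodup_of_pairwise_headLT h)
        (nodup_of_pairwise_headLT h') he)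
  · intro C hC
    obtain ⟨c, hc, he⟩ := exists_stirling2_toFinset_eq hC
    exact ⟨c, mem_stirling2.mpr hc, he⟩
  · intro c hc
    rw [List.prod_toFinset _ (nodup_of_pairwise_headLT (pairwise_headLT (mem_stirling2.mp hc)))]

lemma exists_strictMono_image_range (S : Finset ℕ) :
    ∃ φ : ℕ → ℕ, StrictMono φ ∧ (Finset.range S.card).image φ = S := by
  induction S using Finset.induction_on_max with
  | empty => exact ⟨id, strictMono_id, by simp⟩
  | insert a S ha ih =>
    obtain ⟨φ, hφ, hS⟩ := ih
    have hlt : ∀ i < S.card, φ i < a := fun i hi =>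
      ha _ (hS ▸ Finset.mem_image_of_mem φ (Finset.mem_range.mpr hi))
    refine ⟨fun k => if k < S.card then φ k else a + (k - S.card), ?_, ?_⟩
    · intro i j hij
      have := hφ hij
      have := hlt i
      simp only
      split_ifs <;> omega
    · rw [Finset.card_insert_of_notMem fun h => (ha a h).false, Finset.range_add_one,
        Finset.image_insert]
      congr 1
      · simp
      · exact (Finset.image_congr fun k hk => if_pos (by simpa using hk)).trans hS

lemma isStirlingWord_iff_getD (l : List ℕ) :
    IsStirlingWord l ↔ ∀ i j k, i < j → j < k → k < l.length →
      l.getD i 0 = l.getD k 0 → l.getD i 0 < l.getD j 0 := by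
  constructor
  · intro h i j k hij hjk hk he
    have := h ⟨i, by omega⟩ ⟨j, by omega⟩ ⟨k, hk⟩ hij hjk
    rw [List.getD_eq_getElem _ _ (by omega), List.getD_eq_getElem _ _ (by omega)] at he ⊢
    exact this he
  · intro h i j k hij hjk he
    have := h i j k hij hjk k.2
    rw [List.getD_eq_getElem _ _ i.2, List.getD_eq_getElem _ _ j.2,
      List.getD_eq_getElem _ _ k.2] at this
    exact this he

lemma getD_map_of_lt {α β : Type*} (φ : α → β) (w : List α) {i : ℕ} (hi : i < w.length)
    (a : α) (b : β) : (w.map φ).getD i b = φ (w.getD i a) := by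
  rw [List.getD_eq_getElem _ _ (by simpa using hi), List.getD_eq_getElem _ _ hi, List.getElem_map]

lemma isCycleWord_map {φ : ℕ → ℕ} (hφ : StrictMono φ) (w : List ℕ) :
    IsCycleWord (w.map φ) ↔ IsCycleWord w := by
  have hs : IsStirlingWord (w.map φ) ↔ IsStirlingWord w := by
    simp only [isStirlingWord_iff_getD, List.length_map]
    refine forall₃_congr fun i j k => forall₃_congr fun hij hjk hk => ?_
    rw [getD_map_of_lt φ w (by omega : i < _) 0, getD_map_of_lt φ w (by omega : j < _) 0,
      getD_map_of_lt φ w hk 0, hφ.injective.eq_iff, hφ.lt_iff_lt]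
  unfold IsCycleWord
  rw [hs]
  simp only [List.forall_mem_map, List.count_map_of_injective _ _ hφ.injective]
  cases w with
  | nil => simp
  | cons a l => simp [hφ.le_iff_le]

lemma wordCap_map {φ : ℕ → ℕ} (hφ : StrictMono φ) (w : List ℕ) :
    wordCap (w.map φ) = wordCap w := by
  unfold wordCap
  rw [List.length_map]
  congr 1
  refine Finset.filter_congr fun i _ => and_congr_right fun h0 => and_congr_right fun h1 => ?_
  rw [getD_map_of_lt φ w (by omega) 0, getD_map_of_lt φ w (by omega) 0,
      getD_map_of_lt φ w h1 0, hφ.injective.eq_iff, hφ.lt_iff_lt]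

lemma sum_cycleSets_image {M : Type*} [CommSemiring M] {φ : ℕ → ℕ} (hφ : StrictMono φ)
    (S : Finset ℕ) (f : List ℕ → M) (hf : ∀ w, f (w.map φ) = f w) :
    ∑ C ∈ cycleSets (S.image φ), ∏ w ∈ C, f w = ∑ C ∈ cycleSets S, ∏ w ∈ C, f w := by
  have hinj : Function.Injective (List.map φ) := List.map_injective_iff.mpr hφ.injective
  have htf : ∀ w : List ℕ, (w.map φ).toFinset = w.toFinset.image φ := fun w => by
    ext; simp
  have hmem : ∀ C : Finset (List ℕ),
      C.image (List.map φ) ∈ cycleSets (S.image φ) ↔ C ∈ cycleSets S := by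
    intro C
    rw [mem_cycleSets, mem_cycleSets]
    refine and_congr (by simp [isCycleWord_map hφ]) (and_congr ?_ ?_)
    · rw [Finset.coe_image, Set.InjOn.pairwiseDisjoint_image hinj.injOn]
      simp only [Set.PairwiseDisjoint, Set.Pairwise, Function.onFun, Function.comp_apply, htf,
        Finset.disjoint_image hφ.injective]
    · rw [← (Finset.image_injective hφ.injective).eq_iff (b := S), Finset.image_biUnion,
        Finset.biUnion_image]
      simp only [htf]
  symm
  refine Finset.sum_bij (fun C _ => C.image (List.map φ)) (fun C hC => (hmem C).mpr hC)
    (fun C _ C' _ h => Finset.image_injective hinj h) ?_ ?_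
  · intro D hD
    have hr : (D : Set (List ℕ)) ⊆ Set.range (List.map φ) := by
      intro w hw
      rw [Set.range_list_map]
      intro v hv
      have : v ∈ S.image φ := by
        rw [← (mem_cycleSets.mp hD).2.2]
        exact Finset.mem_biUnion.mpr ⟨w, hw, List.mem_toFinset.mpr hv⟩
      obtain ⟨u, -, hu⟩ := Finset.mem_image.mp this
      exact ⟨u, hu⟩
    obtain ⟨C, rfl⟩ : ∃ C : Finset (List ℕ), C.image (List.map φ) = D :=
      ⟨D.preimage _ hinj.injOn, by
        rw [Finset.image_preimage, Finset.filter_true_of_mem fun w hw => hr hw]⟩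
    exact ⟨C, (hmem C).mp hD, rfl⟩
  · intro C _
    rw [Finset.prod_image hinj.injOn]
    simp only [hf]

lemma sum_cycleSets_eq_of_card_eq {M : Type*} [CommSemiring M] {S T : Finset ℕ}
    (h : S.card = T.card) (f : List ℕ → M)
    (hf : ∀ φ, StrictMono φ → ∀ w, f (w.map φ) = f w) :
    ∑ C ∈ cycleSets S, ∏ w ∈ C, f w = ∑ C ∈ cycleSets T, ∏ w ∈ C, f w := by
  obtain ⟨φ, hφ, hS⟩ := exists_strictMono_image_range S
  obtain ⟨ψ, hψ, hT⟩ := exists_strictMono_image_range T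
  rw [← hS, ← hT, h, sum_cycleSets_image hφ _ f (hf φ hφ), sum_cycleSets_image hψ _ f (hf ψ hψ)]

lemma isCycleWord_pair (k : ℕ) : IsCycleWord [k, k] := by
  refine ⟨by simp, by simp, by simp, ?_⟩
  rw [isStirlingWord_iff_getD]
  intro i j l hij hjl hl
  simp only [List.length_cons, List.length_nil] at hl
  omega

lemma wordCap_pair (k : ℕ) : wordCap [k, k] = 0 := by
  rw [wordCap, Finset.card_eq_zero, Finset.filter_eq_empty_iff]
  rintro i - ⟨h0, h1, -⟩
  simp only [List.length_cons, List.length_nil] at h1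
  omega

lemma pair_injective : Function.Injective fun k : ℕ => [k, k] := fun a b h => by simpa using h

lemma biUnion_image_pair (T : Finset ℕ) :
    (T.image fun k => [k, k]).biUnion List.toFinset = T := by
  ext v; simp

lemma union_image_pair_mem_cycleSets {S T : Finset ℕ} (hT : T ⊆ S) {t : Finset (List ℕ)}
    (ht : t ∈ cycleSets (S \ T)) : t ∪ T.image (fun k => [k, k]) ∈ cycleSets S := by
  obtain ⟨hw, hd, hu⟩ := mem_cycleSets.mp ht
  rw [mem_cycleSets]
  refine ⟨?_, ?_, ?_⟩
  · intro w hw'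
    rcases Finset.mem_union.mp hw' with h | h
    · exact hw w h
    · obtain ⟨k, -, rfl⟩ := Finset.mem_image.mp h
      exact isCycleWord_pair k
  · rw [Finset.coe_union, Set.pairwiseDisjoint_union]
    refine ⟨hd, ?_, ?_⟩
    · intro a ha b hb hne
      obtain ⟨k, -, rfl⟩ := Finset.mem_image.mp (Finset.mem_coe.mp ha)
      obtain ⟨l, -, rfl⟩ := Finset.mem_image.mp (Finset.mem_coe.mp hb)
      have : k ≠ l := fun h => hne (by rw [h])
      simpa [Function.onFun] using this
    · intro a ha b hb _
      obtain ⟨k, hk, rfl⟩ := Finset.mem_image.mp (Finset.mem_coe.mp hb)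
      have hsub : a.toFinset ⊆ S \ T := hu ▸ Finset.subset_biUnion_of_mem List.toFinset ha
      have hkT : k ∉ a.toFinset := fun h => (Finset.mem_sdiff.mp (hsub h)).2 hk
      simpa using hkT
  · rw [Finset.union_biUnion, hu, biUnion_image_pair, Finset.sdiff_union_of_subset hT]

lemma disjoint_image_pair {S T : Finset ℕ} {t : Finset (List ℕ)}
    (ht : t ∈ cycleSets (S \ T)) : Disjoint t (T.image fun k => [k, k]) := by
  rw [Finset.disjoint_left]
  intro w hwt hwT
  obtain ⟨k, hk, rfl⟩ := Finset.mem_image.mp hwT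
  have hsub := Finset.subset_biUnion_of_mem List.toFinset hwt
  rw [(mem_cycleSets.mp ht).2.2] at hsub
  exact (Finset.mem_sdiff.mp (hsub (show k ∈ [k, k].toFinset by simp))).2 hk

lemma sdiff_mem_cycleSets {S : Finset ℕ} {C t : Finset (List ℕ)} (hC : C ∈ cycleSets S)
    (ht : t ⊆ C) : t ∈ cycleSets (S \ (C \ t).biUnion List.toFinset) := by
  obtain ⟨hw, hd, hu⟩ := mem_cycleSets.mp hC
  refine mem_cycleSets.mpr ⟨fun w h => hw w (ht h), hd.subset (by exact_mod_cast ht), ?_⟩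
  have hdis : Disjoint (t.biUnion List.toFinset) ((C \ t).biUnion List.toFinset) := by
    rw [Finset.disjoint_biUnion_left]
    intro a ha
    rw [Finset.disjoint_biUnion_right]
    intro b hb
    obtain ⟨hbC, hbt⟩ := Finset.mem_sdiff.mp hb
    exact hd (ht ha) hbC fun h => hbt (h ▸ ha)
  rw [← hu, ← Finset.union_sdiff_of_subset ht, Finset.union_biUnion,
    Finset.union_sdiff_of_subset ht, Finset.union_sdiff_cancel_right hdis]

/-- Expanding a weight `f + z·[fixed point]` over the cycles by choosing the set `T` of marked
fixed points. -/
lemma sum_cycleSets_add_pair {M : Type*} [CommSemiring M] (S : Finset ℕ) (f : List ℕ → M)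
    (z : M) :
    ∑ C ∈ cycleSets S, ∏ w ∈ C, (f w + if ∃ k : ℕ, w = [k, k] then z else 0) =
      ∑ T ∈ S.powerset, z ^ T.card * ∑ t ∈ cycleSets (S \ T), ∏ w ∈ t, f w := by
  simp only [Finset.prod_add, Finset.mul_sum]
  rw [Finset.sum_sigma', Finset.sum_sigma']
  symm
  refine Finset.sum_of_injOn (fun p => ⟨p.2 ∪ p.1.image (fun k => [k, k]), p.2⟩) ?_ ?_ ?_ ?_
  · rintro ⟨T, t⟩ hp ⟨T', t'⟩ hp' he
    simp only [Finset.coe_sigma, Set.mem_sigma_iff, Finset.mem_coe, Finset.mem_powerset]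
      at hp hp'
    simp only [Sigma.mk.injEq, heq_eq_eq] at he
    obtain ⟨h1, rfl⟩ := he
    have h2 := (mem_cycleSets.mp hp.2).2.2.symm.trans (mem_cycleSets.mp hp'.2).2.2
    have : T = T' := by
      rw [← Finset.sdiff_sdiff_eq_self hp.1, h2, Finset.sdiff_sdiff_eq_self hp'.1]
    rw [this]
  · rintro ⟨T, t⟩ hp
    simp only [Finset.coe_sigma, Set.mem_sigma_iff, Finset.mem_coe, Finset.mem_powerset] at hp ⊢
    exact ⟨union_image_pair_mem_cycleSets hp.1 hp.2, Finset.subset_union_left⟩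
  · rintro ⟨C, t⟩ hp hn
    simp only [Finset.mem_sigma, Finset.mem_powerset] at hp
    obtain ⟨hC, ht⟩ := hp
    by_cases hall : ∀ w ∈ C \ t, ∃ k : ℕ, w = [k, k]
    · refine absurd ?_ hn
      have himg : ((C \ t).biUnion List.toFinset).image (fun k => [k, k]) = C \ t := by
        ext w
        simp only [Finset.mem_image, Finset.mem_biUnion, List.mem_toFinset]
        constructor
        · rintro ⟨k, ⟨u, hu, hk⟩, rfl⟩
          obtain ⟨l, rfl⟩ := hall u hu
          obtain rfl : k = l := by simpa using hk
          exact hu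
        · intro hw
          obtain ⟨k, rfl⟩ := hall w hw
          exact ⟨k, ⟨_, hw, by simp⟩, rfl⟩
      refine ⟨⟨(C \ t).biUnion List.toFinset, t⟩, ?_, ?_⟩
      · simp only [Finset.coe_sigma, Set.mem_sigma_iff, Finset.mem_coe, Finset.mem_powerset]
        refine ⟨?_, sdiff_mem_cycleSets hC ht⟩
        exact (Finset.biUnion_subset_biUnion_of_subset_left _ Finset.sdiff_subset).trans
          (mem_cycleSets.mp hC).2.2.subset
      · simp only [himg, Finset.union_sdiff_of_subset ht]
    · push Not at hall
      obtain ⟨w, hw, hk⟩ := hall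
      refine mul_eq_zero_of_right _ (Finset.prod_eq_zero hw (if_neg ?_))
      rintro ⟨k, h⟩
      exact hk k h
  · rintro ⟨T, t⟩ hp
    simp only [Finset.mem_sigma, Finset.mem_powerset] at hp
    simp only
    rw [Finset.union_sdiff_cancel_left (disjoint_image_pair hp.2),
      Finset.prod_image pair_injective.injOn, mul_comm]
    simp

lemma fixSt_cons (w : List ℕ) (c : List (List ℕ)) :
    fixSt (w :: c) = fixSt c + if ∃ k : ℕ, w = [k, k] then 1 else 0 := by
  simp only [fixSt, Finset.card_filter, List.length_cons]
  rw [Finset.sum_range_succ']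
  simp

lemma capSt_cons (w : List ℕ) (c : List (List ℕ)) :
    capSt (w :: c) = wordCap w + capSt c := by
  simp [capSt, wordCap]

open MvPolynomial in
lemma Qmv_eq_sum (m : ℕ) :
    Qmv m = ∑ C ∈ cycleSets (Finset.Icc 1 m),
      ∏ w ∈ C, ((X 0 : MvPolynomial (Fin 3) ℚ) ^ wordCap w * X 2) := by
  rw [← sum_stirling2, Qmv]
  refine Finset.sum_congr rfl fun c hc => ?_
  clear hc
  induction c with
  | nil => simp [capSt, cyc]
  | cons w c ih =>
    rw [List.map_cons, List.prod_cons, ← ih, capSt_cons, cyc, cyc, List.length_cons]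
    ring

open MvPolynomial in
lemma Pmv_eq_sum (n : ℕ) :
    Pmv n = ∑ C ∈ cycleSets (Finset.Icc 1 n),
      ∏ w ∈ C, ((X 0 : MvPolynomial (Fin 3) ℚ) ^ wordCap w * X 2 +
        if ∃ k : ℕ, w = [k, k] then X 1 * X 2 - X 2 else 0) := by
  rw [← sum_stirling2, Pmv]
  refine Finset.sum_congr rfl fun c hc => ?_
  clear hc
  induction c with
  | nil => simp [capSt, cyc, fixSt]
  | cons w c ih =>
    rw [List.map_cons, List.prod_cons, ← ih, capSt_cons, fixSt_cons, cyc, cyc, List.length_cons]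
    split_ifs with h
    · obtain ⟨k, rfl⟩ := h
      rw [wordCap_pair]
      ring
    · ring

open MvPolynomial in
/-- For every `n ≥ 0`:  `P_n(x,y,q) = ∑_{i=0}^n C(n,i) (yq - q)^i Q_{n-i}(x,q)`. -/
theorem stmt14 (n : ℕ) :
    Pmv n =
      ∑ i ∈ Finset.range (n + 1),
        (n.choose i : MvPolynomial (Fin 3) ℚ) * (X 1 * X 2 - X 2) ^ i * Qmv (n - i) := by
  rw [Pmv_eq_sum, sum_cycleSets_add_pair]
  have h : ∀ T ∈ (Finset.Icc 1 n).powerset,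
      ((X 1 * X 2 - X 2 : MvPolynomial (Fin 3) ℚ) ^ T.card *
        ∑ t ∈ cycleSets (Finset.Icc 1 n \ T), ∏ w ∈ t, (X 0 ^ wordCap w * X 2)) =
      (X 1 * X 2 - X 2) ^ T.card * Qmv (n - T.card) := by
    intro T hT
    rw [Qmv_eq_sum]
    congr 1
    refine sum_cycleSets_eq_of_card_eq ?_ _ fun φ hφ w => by rw [wordCap_map hφ]
    rw [Finset.card_sdiff_of_subset (Finset.mem_powerset.mp hT)]
    simp
  rw [Finset.sum_congr rfl h, Finset.sum_powerset_apply_card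
    fun i => (X 1 * X 2 - X 2 : MvPolynomial (Fin 3) ℚ) ^ i * Qmv (n - i)]
  simp [nsmul_eq_mul, mul_assoc]
end
end
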